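/- arXiv:1909.13729 — 15 statements merged into one kernel-verified Lean document; each statement's English description precedes it below -/
import Mathlib

section
/- Let R ⊊ S be an FCP ring extension. Call T ∈ [R,S] essential if T ≠ ⊥ and T ⊓ U ≠ ⊥ for every U ∈ [R,S] with U ≠ ⊥. Then the socle 𝒮[R,S] := sSup {A ∈ [R,S] | A is an atom} is an essential element of [R,S], and it is the least essential element: 𝒮[R,S] ≤ E for every essential E; consequently 𝒮[R,S] = sInf {E ∈ [R,S] | E is essential}. -/
/-- An element `T` of the lattice of `R`-subalgebras of `S` is *essential* if
`T ≠ ⊥` and `T ⊓ U ≠ ⊥` for every `U ≠ ⊥`. -/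
def Subalgebra.IsEssential {R S : Type*} [CommRing R] [CommRing S] [Algebra R S]
    (T : Subalgebra R S) : Prop :=
  T ≠ ⊥ ∧ ∀ U : Subalgebra R S, U ≠ ⊥ → T ⊓ U ≠ ⊥

/-- In an atomic lattice of subalgebras, the join of the atoms is essential. -/
theorem Subalgebra.isEssential_sSup_isAtom {R S : Type*} [CommRing R] [CommRing S] [Algebra R S]
    [IsAtomic (Subalgebra R S)] (hRS : (⊥ : Subalgebra R S) ≠ ⊤) :
    Subalgebra.IsEssential (sSup {A : Subalgebra R S | IsAtom A}) := by
  have inf_ne_bot : ∀ U : Subalgebra R S, U ≠ ⊥ →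
      sSup {A : Subalgebra R S | IsAtom A} ⊓ U ≠ ⊥ := fun U hU => by
    obtain ⟨A, hA, hAU⟩ := (eq_bot_or_exists_atom_le U).resolve_left hU
    exact ne_bot_of_le_ne_bot hA.1 (le_inf (le_sSup hA) hAU)
  exact ⟨ne_bot_of_le_ne_bot (inf_ne_bot ⊤ hRS.symm) inf_le_left, inf_ne_bot⟩

/-- An essential subalgebra contains every atom. -/
theorem Subalgebra.IsEssential.sSup_isAtom_le {R S : Type*} [CommRing R] [CommRing S]
    [Algebra R S] {E : Subalgebra R S} (hE : E.IsEssential) :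
    sSup {A : Subalgebra R S | IsAtom A} ≤ E :=
  sSup_le fun A hA => by
    have hEA : E ⊓ A = A := (hA.le_iff.mp inf_le_right).resolve_left (hE.2 A hA.1)
    exact inf_eq_right.mp hEA

theorem socle_isEssential_and_least
    {R S : Type*} [CommRing R] [CommRing S] [Algebra R S]
    (hinj : Function.Injective (algebraMap R S))
    [WellFoundedLT (Subalgebra R S)] [WellFoundedGT (Subalgebra R S)]
    (hRS : (⊥ : Subalgebra R S) ≠ ⊤) :
    Subalgebra.IsEssential (sSup {A : Subalgebra R S | IsAtom A}) ∧
    (∀ E : Subalgebra R S, Subalgebra.IsEssential E →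
      sSup {A : Subalgebra R S | IsAtom A} ≤ E) ∧
    sSup {A : Subalgebra R S | IsAtom A} =
      sInf {E : Subalgebra R S | Subalgebra.IsEssential E} := by
  have hS := Subalgebra.isEssential_sSup_isAtom hRS
  exact ⟨hS, fun _ hE => hE.sSup_isAtom_le,
    le_antisymm (le_sInf fun _ hE => hE.sSup_isAtom_le) (sInf_le hS)⟩
end

section
/- Let R ⊊ S be an FCP ring extension. Then £[R,S] ≤ ℓ[R,S] ≤ L_R(S/R), where £[R,S] is the Loewy length, ℓ[R,S] is the supremum of the lengths of chains in [R,S] (the Krull dimension of the order `Subalgebra R S`), and L_R(S/R) is the length of the R-module S/R, i.e. the length of the quotient of S by the R-submodule (⊥ : Subalgebra R S).toSubmodule. -/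
/-- The Loewy series of the ring extension `R ⊆ S`: `S_0 = ⊥` and
`S_{i+1} = S_i ⊔ sSup {A | S_i ⋖ A}`. -/
noncomputable def loewySeries (R S : Type*) [CommRing R] [CommRing S] [Algebra R S] :
    ℕ → Subalgebra R S
  | 0 => ⊥
  | n + 1 => loewySeries R S n ⊔ sSup {A : Subalgebra R S | loewySeries R S n ⋖ A}

/-- The Loewy series strictly increases at every stage that is not yet `⊤`. -/
lemma loewySeries_lt_succ {R S : Type*} [CommRing R] [CommRing S] [Algebra R S]
    [WellFoundedLT (Subalgebra R S)] {i : ℕ} (hi : loewySeries R S i ≠ ⊤) :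
    loewySeries R S i < loewySeries R S (i + 1) := by
  obtain ⟨A, hA, -⟩ := (lt_top_iff_ne_top.mpr hi).exists_covby_le
  refine hA.lt.trans_le ?_
  rw [loewySeries]
  exact (le_sSup (show A ∈ {A | loewySeries R S i ⋖ A} from hA)).trans le_sup_right

/-- Taking the image in the quotient by a submodule `N` is strictly monotone on the
submodules containing `N`. -/
lemma Submodule.map_mkQ_lt_map_mkQ {R M : Type*} [Ring R] [AddCommGroup M] [Module R M]
    {N P Q : Submodule R M} (hN : N ≤ P) (h : P < Q) : P.map N.mkQ < Q.map N.mkQ := by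
  refine lt_of_le_not_ge (Submodule.map_mono h.le) fun hle => h.not_ge ?_
  have := Submodule.comap_mono (f := N.mkQ) hle
  rwa [Submodule.comap_map_mkQ, Submodule.comap_map_mkQ, sup_eq_right.mpr hN,
    sup_eq_right.mpr (hN.trans h.le)] at this

theorem loewyLength_le_length_le_moduleLength
    {R S : Type*} [CommRing R] [CommRing S] [Algebra R S]
    (hinj : Function.Injective (algebraMap R S))
    [WellFoundedLT (Subalgebra R S)] [WellFoundedGT (Subalgebra R S)]
    (hRS : (⊥ : Subalgebra R S) ≠ ⊤)
    (n : ℕ) (hn : IsLeast {m : ℕ | loewySeries R S m = ⊤} n) :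
    (n : WithBot ℕ∞) ≤ Order.krullDim (Subalgebra R S) ∧
      Order.krullDim (Subalgebra R S) ≤
        Order.krullDim (Submodule R (S ⧸ (⊥ : Subalgebra R S).toSubmodule)) := by
  constructor
  · let p : LTSeries (Subalgebra R S) :=
      { length := n
        toFun := fun i => loewySeries R S i
        step := fun i => loewySeries_lt_succ fun h => (hn.2 h).not_gt i.2 }
    exact Order.LTSeries.length_le_krullDim p
  · exact Order.krullDim_le_of_strictMono
      (fun T : Subalgebra R S => T.toSubmodule.map (⊥ : Subalgebra R S).toSubmodule.mkQ)
      fun _ _ h => Submodule.map_mkQ_lt_map_mkQ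
        (Subalgebra.toSubmodule.monotone bot_le) (Subalgebra.toSubmodule.strictMono h)
end

section
/- Let R ⊊ S be a distributive FCP ring extension and let S_1 := sSup {A ∈ [R,S] | A is an atom} be its socle. Then S_1 = sSup {T ∈ [R,S] | the interval [⊥,T] is Boolean}; that is, the socle is the largest R-subalgebra T of S such that the extension R ⊆ T is Boolean. -/
/-- The interval `[T, U]` of a lattice is *Boolean* if it is distributive and every
element of the interval has a complement within the interval. -/
def IsBooleanInterval {α : Type*} [Lattice α] (T U : α) : Prop :=
  (∀ a b c : α, T ≤ a → a ≤ U → T ≤ b → b ≤ U → T ≤ c → c ≤ U →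
      a ⊓ (b ⊔ c) = (a ⊓ b) ⊔ (a ⊓ c)) ∧
  ∀ v : α, T ≤ v → v ≤ U → ∃ w : α, T ≤ w ∧ w ≤ U ∧ v ⊓ w = T ∧ v ⊔ w = U

/-- In a lattice where every nonzero element lies above an atom, an element whose lower interval
is Boolean lies below the socle. -/
theorem IsBooleanInterval.le_sSup_atoms {α : Type*} [CompleteLattice α] [IsAtomic α] {T : α}
    (hT : IsBooleanInterval ⊥ T) : T ≤ sSup {A : α | IsAtom A} := by
  obtain ⟨w, -, hwT, hinf, hsup⟩ := hT.2 (T ⊓ sSup {A : α | IsAtom A}) bot_le inf_le_left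
  rcases eq_bot_or_exists_atom_le w with rfl | ⟨A, hA, hAw⟩
  · rw [sup_bot_eq] at hsup
    exact inf_eq_left.mp hsup
  · have hle : A ≤ T ⊓ sSup {A : α | IsAtom A} ⊓ w :=
      le_inf (le_inf (hAw.trans hwT) (le_sSup hA)) hAw
    exact absurd (le_bot_iff.mp (hle.trans_eq hinf)) hA.1

/-- In a distributive complete lattice with the ascending chain condition, the lower interval of
the socle is Boolean. -/
theorem isBooleanInterval_bot_sSup_atoms {α : Type*} [CompleteLattice α] [WellFoundedGT α]
    (hdist : ∀ a b c : α, a ⊓ (b ⊔ c) = (a ⊓ b) ⊔ (a ⊓ c)) :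
    IsBooleanInterval ⊥ (sSup {A : α | IsAtom A}) := by
  refine ⟨fun a b c _ _ _ _ _ _ => hdist a b c, fun v _ hv => ?_⟩
  obtain ⟨w, ⟨hw, hvw⟩, hmax⟩ := wellFounded_gt.has_min
    {w : α | w ≤ sSup {A : α | IsAtom A} ∧ v ⊓ w = ⊥} ⟨⊥, bot_le, inf_bot_eq v⟩
  refine ⟨w, bot_le, hw, hvw, le_antisymm (sup_le hv hw) (sSup_le fun A hA => ?_)⟩
  by_contra hAvw
  have hvA : v ⊓ A = ⊥ :=
    (hA.not_le_iff_disjoint.mp fun h => hAvw (h.trans le_sup_left)).symm.eq_bot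
  refine hmax (w ⊔ A) ⟨sup_le hw (le_sSup hA), by rw [hdist, hvw, hvA, sup_bot_eq]⟩ ?_
  exact left_lt_sup.mpr fun h => hAvw (h.trans le_sup_right)

theorem socle_eq_sSup_boolean
    {R S : Type*} [CommRing R] [CommRing S] [Algebra R S]
    (hinj : Function.Injective (algebraMap R S))
    [WellFoundedLT (Subalgebra R S)] [WellFoundedGT (Subalgebra R S)]
    (hRS : (⊥ : Subalgebra R S) ≠ ⊤)
    (hdist : ∀ a b c : Subalgebra R S, a ⊓ (b ⊔ c) = (a ⊓ b) ⊔ (a ⊓ c)) :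
    sSup {A : Subalgebra R S | IsAtom A} =
      sSup {T : Subalgebra R S | IsBooleanInterval ⊥ T} ∧
    IsGreatest {T : Subalgebra R S | IsBooleanInterval ⊥ T}
      (sSup {A : Subalgebra R S | IsAtom A}) := by
  have hgreatest : IsGreatest {T : Subalgebra R S | IsBooleanInterval ⊥ T}
      (sSup {A : Subalgebra R S | IsAtom A}) :=
    ⟨isBooleanInterval_bot_sSup_atoms hdist, fun _ hT => hT.le_sSup_atoms⟩
  exact ⟨hgreatest.isLUB.sSup_eq.symm, hgreatest⟩
end

section
/- Let R ⊊ S be a distributive FCP ring extension. Then for every T ∈ [R,S] with T ≠ ⊥, sSup {A ∈ [R,S] | A is an atom and A ≤ T} = (sSup {A ∈ [R,S] | A is an atom}) ⊓ T; that is, the socle of the interval [⊥,T] equals 𝒮[R,S] ⊓ T, where 𝒮[R,S] is the socle of [R,S]. -/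
/-- In a distributive complete lattice satisfying the ascending chain condition, the join of the
atoms below `t` is the meet of `t` with the join of all atoms. -/
theorem sSup_isAtom_le_eq_sSup_isAtom_inf {L : Type*} [CompleteLattice L] [WellFoundedGT L]
    (hdist : ∀ a b c : L, a ⊓ (b ⊔ c) = (a ⊓ b) ⊔ (a ⊓ c)) (t : L) :
    sSup {a : L | IsAtom a ∧ a ≤ t} = sSup {a : L | IsAtom a} ⊓ t := by
  classical
  apply le_antisymm
  · exact sSup_le fun a ha => le_inf (le_sSup ha.1) ha.2
  · obtain ⟨s, hs, hsup⟩ :=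
      CompleteLattice.WellFoundedGT.isSupFiniteCompact L {a : L | IsAtom a}
    rw [hsup, inf_comm]
    clear hsup
    induction s using Finset.induction_on with
    | empty => simp
    | insert a s _ ih =>
      rw [Finset.coe_insert, Set.insert_subset_iff] at hs
      rw [Finset.sup_insert, hdist]
      refine sup_le ?_ (ih hs.2)
      rcases hs.1.le_iff.mp (inf_le_right : t ⊓ a ≤ a) with h | h
      · exact h.le.trans bot_le
      · exact h.le.trans (le_sSup ⟨hs.1, inf_eq_right.mp h⟩)

theorem socle_of_interval_eq_socle_inf
    {R S : Type*} [CommRing R] [CommRing S] [Algebra R S]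
    (hinj : Function.Injective (algebraMap R S))
    [WellFoundedLT (Subalgebra R S)] [WellFoundedGT (Subalgebra R S)]
    (hRS : (⊥ : Subalgebra R S) ≠ ⊤)
    (hdist : ∀ a b c : Subalgebra R S, a ⊓ (b ⊔ c) = (a ⊓ b) ⊔ (a ⊓ c)) :
    ∀ T : Subalgebra R S, T ≠ ⊥ →
      sSup {A : Subalgebra R S | IsAtom A ∧ A ≤ T} =
        sSup {A : Subalgebra R S | IsAtom A} ⊓ T := by
  exact fun T _ => sSup_isAtom_le_eq_sSup_isAtom_inf hdist T
end

section
/- Let R ⊊ S be a distributive FCP ring extension with Loewy series {S_i} and Loewy length n. Then for every i < n the interval [S_i, S_{i+1}] of [R,S] is Boolean. Moreover ℓ[R,S] = Σ_{i=0}^{n-1} ℓ[S_i, S_{i+1}], where ℓ of an interval denotes the supremum of the lengths of chains in that interval (its Krull dimension as an order). -/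
/-- In a distributive complete lattice with the ascending chain condition, the interval from `T` to
the join of all its covers is Boolean. -/
theorem isBooleanInterval_sup_sSup_covers {α : Type*} [CompleteLattice α] [WellFoundedGT α]
    (hdist : ∀ a b c : α, a ⊓ (b ⊔ c) = (a ⊓ b) ⊔ (a ⊓ c)) (T : α) :
    IsBooleanInterval T (T ⊔ sSup {A | T ⋖ A}) := by
  refine ⟨fun a b c _ _ _ _ _ _ => hdist a b c, fun v hTv hvU => ?_⟩
  set U := T ⊔ sSup {A | T ⋖ A}
  obtain ⟨w, ⟨hTw, hwU, hvw⟩, hmax⟩ := wellFounded_gt.has_min {w | T ≤ w ∧ w ≤ U ∧ v ⊓ w ≤ T}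
    ⟨T, le_rfl, le_sup_left, inf_le_right⟩
  refine ⟨w, hTw, hwU, le_antisymm hvw (le_inf hTv hTw), le_antisymm (sup_le hvU hwU) ?_⟩
  refine sup_le (hTv.trans le_sup_left) (sSup_le fun A hA => ?_)
  rcases hA.eq_or_eq (le_inf hTv hA.le) inf_le_right with h | h
  · have hAw : ¬ w < w ⊔ A := hmax _ ⟨hTw.trans le_sup_left,
      sup_le hwU ((le_sSup hA).trans le_sup_right), by
        rw [hdist]; exact sup_le hvw h.le⟩
    rw [left_lt_sup, not_not] at hAw
    exact hAw.trans le_sup_right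
  · exact (inf_eq_right.mp h).trans le_sup_left

/-- Heights in a modular lattice are additive along intervals. -/
theorem Order.height_eq_height_add_krullDim_Icc {α : Type*} [Lattice α] [IsModularLattice α]
    {b c : α} (hbc : b ≤ c) :
    (Order.height c : WithBot ℕ∞) = Order.height b + Order.krullDim (Set.Icc b c) := by
  apply le_antisymm
  · have key : ∀ (p : LTSeries α) (hp : p.last ≤ c), (p.length : ℕ∞) ≤
        Order.height (p.last ⊓ b) +
          Order.height (⟨p.last ⊔ b, le_sup_right, sup_le hp hbc⟩ : Set.Icc b c) := by
      intro p
      induction p using RelSeries.inductionOn' with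
      | singleton x => simp
      | snoc p x hx ih =>
        intro hp
        have hxc : x ≤ c := by simpa using hp
        have hlt : p.last < x := hx
        have ih := ih (hlt.le.trans hxc)
        simp only [RelSeries.last_snoc, RelSeries.snoc_length, Nat.cast_add, Nat.cast_one]
        rcases (inf_le_inf_right b hlt.le).lt_or_eq with h | h
        · calc (p.length : ℕ∞) + 1 ≤ _ := add_le_add_left ih 1
            _ = (Order.height (p.last ⊓ b) + 1) + Order.height _ := add_right_comm _ _ _
            _ ≤ _ := add_le_add (Order.height_add_one_le h)
              (Order.height_mono (Subtype.mk_le_mk.mpr (sup_le_sup_right hlt.le b)))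
        · calc (p.length : ℕ∞) + 1 ≤ _ := add_le_add_left ih 1
            _ = Order.height (p.last ⊓ b) + (Order.height _ + 1) := add_assoc _ _ _
            _ ≤ _ := add_le_add (Order.height_mono h.le)
              (Order.height_add_one_le (Subtype.mk_lt_mk.mpr
                (sup_lt_sup_of_lt_of_inf_le_inf hlt h.ge)))
    obtain ⟨k, hk⟩ : ∃ k : ℕ∞, Order.krullDim (Set.Icc b c) = k := by
      have : Nonempty (Set.Icc b c) := ⟨⟨b, le_rfl, hbc⟩⟩
      exact ⟨_, Order.krullDim_eq_iSup_height_of_nonempty⟩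
    rw [hk]
    norm_cast
    refine Order.height_le_iff.mpr fun p hp => (key p hp).trans
      (add_le_add (Order.height_mono inf_le_right) ?_)
    exact WithBot.coe_le_coe.mp (hk ▸ Order.height_le_krullDim _)
  · let b' : Set.Iic c := ⟨b, hbc⟩
    have : Nonempty (Set.Iic c) := ⟨b'⟩
    have hlow : (Order.height b : WithBot ℕ∞) ≤ Order.height b' := by
      rw [Order.height_eq_krullDim_Iic, Order.height_eq_krullDim_Iic]
      exact Order.krullDim_le_of_strictMono
        (fun x : Set.Iic b => (⟨⟨x, le_trans x.2 hbc⟩, x.2⟩ : Set.Iic b')) fun _ _ h => h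
    have hhigh : Order.krullDim (Set.Icc b c) ≤ Order.coheight b' := by
      rw [Order.coheight_eq_krullDim_Ici]
      exact Order.krullDim_le_of_strictMono
        (fun x : Set.Icc b c => (⟨⟨x, x.2.2⟩, x.2.1⟩ : Set.Ici b')) fun _ _ h => h
    refine (add_le_add hlow hhigh).trans ?_
    rw [Order.height_eq_krullDim_Iic c, Order.krullDim_eq_iSup_height_add_coheight_of_nonempty]
    exact_mod_cast le_iSup (fun a : Set.Iic c => Order.height a + Order.coheight a) b'

/-- In a modular lattice with a least element, the height of a term of an ascending sequence that
starts at `⊥` is the sum of the lengths of the steps below it. -/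
theorem Order.height_eq_sum_krullDim_Icc {α : Type*} [Lattice α] [OrderBot α] [IsModularLattice α]
    {s : ℕ → α} (hs : Monotone s) (h0 : s 0 = ⊥) (n : ℕ) :
    (Order.height (s n) : WithBot ℕ∞) =
      ∑ i ∈ Finset.range n, Order.krullDim (Set.Icc (s i) (s (i + 1))) := by
  induction n with
  | zero => simp [h0]
  | succ n ih =>
    rw [Finset.sum_range_succ, ← ih, Order.height_eq_height_add_krullDim_Icc (hs n.le_succ)]

theorem loewySeries_boolean_steps_and_length_sum
    {R S : Type*} [CommRing R] [CommRing S] [Algebra R S]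
    (hinj : Function.Injective (algebraMap R S))
    [WellFoundedLT (Subalgebra R S)] [WellFoundedGT (Subalgebra R S)]
    (hRS : (⊥ : Subalgebra R S) ≠ ⊤)
    (hdist : ∀ a b c : Subalgebra R S, a ⊓ (b ⊔ c) = (a ⊓ b) ⊔ (a ⊓ c))
    (n : ℕ) (hn : IsLeast {m : ℕ | loewySeries R S m = ⊤} n) :
    (∀ i < n, IsBooleanInterval (loewySeries R S i) (loewySeries R S (i + 1))) ∧
    Order.krullDim (Subalgebra R S) =
      ∑ i ∈ Finset.range n,
        Order.krullDim (Set.Icc (loewySeries R S i) (loewySeries R S (i + 1))) := by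
  have : IsModularLattice (Subalgebra R S) :=
    ⟨fun {x} y {z} hxz => by rw [inf_comm, hdist, inf_eq_right.mpr hxz, inf_comm z y]⟩
  refine ⟨fun i _ => isBooleanInterval_sup_sSup_covers hdist _, ?_⟩
  rw [← Order.height_eq_sum_krullDim_Icc (monotone_nat_of_le_succ fun _ => le_sup_left) rfl,
    show loewySeries R S n = ⊤ from hn.1, Order.height_top_eq_krullDim]
end

section
/- Let R ⊊ S be a distributive FCP ring extension. Then its Loewy length £[R,S] equals 1 — equivalently sSup {A ∈ [R,S] | A is an atom} = ⊤ — if and only if the extension R ⊆ S is Boolean, i.e. the interval [⊥,⊤] = [R,S] is a Boolean lattice. -/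
/-- The first step of the Loewy series is the join of the atoms. -/
theorem loewySeries_one (R S : Type*) [CommRing R] [CommRing S] [Algebra R S] :
    loewySeries R S 1 = sSup {A : Subalgebra R S | IsAtom A} := by
  simp [loewySeries, bot_covBy_iff]

/-- In a compactly generated modular lattice the atoms join to `⊤` iff every element has a
complement. -/
theorem sSup_atoms_eq_top_iff_complementedLattice {α : Type*} [CompleteLattice α]
    [IsModularLattice α] [IsCompactlyGenerated α] :
    sSup {a : α | IsAtom a} = ⊤ ↔ ComplementedLattice α :=
  ⟨complementedLattice_of_sSup_atoms_eq_top, fun _ =>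
    have := isAtomistic_of_complementedLattice (α := α)
    sSup_atoms_eq_top⟩

theorem loewyLength_eq_one_iff_boolean
    {R S : Type*} [CommRing R] [CommRing S] [Algebra R S]
    (hinj : Function.Injective (algebraMap R S))
    [WellFoundedLT (Subalgebra R S)] [WellFoundedGT (Subalgebra R S)]
    (hRS : (⊥ : Subalgebra R S) ≠ ⊤)
    (hdist : ∀ a b c : Subalgebra R S, a ⊓ (b ⊔ c) = (a ⊓ b) ⊔ (a ⊓ c))
    (n : ℕ) (hn : IsLeast {m : ℕ | loewySeries R S m = ⊤} n) :
    (n = 1 ↔ sSup {A : Subalgebra R S | IsAtom A} = ⊤) ∧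
    (n = 1 ↔ ∀ T : Subalgebra R S, ∃ T' : Subalgebra R S,
      T ⊓ T' = ⊥ ∧ T ⊔ T' = ⊤) := by
  have hatoms : n = 1 ↔ sSup {A : Subalgebra R S | IsAtom A} = ⊤ := by
    rw [← loewySeries_one]
    refine ⟨fun h => h ▸ hn.1, fun h => le_antisymm (hn.2 h) (Nat.one_le_iff_ne_zero.2 ?_)⟩
    rintro rfl
    exact hRS hn.1
  have : IsModularLattice (Subalgebra R S) := ⟨fun {x} y z hxz => by
    rw [inf_comm, hdist, inf_eq_right.2 hxz, inf_comm z]⟩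
  have : IsCompactlyGenerated (Subalgebra R S) :=
    CompleteLattice.isCompactlyGenerated_of_wellFoundedGT
  refine ⟨hatoms, hatoms.trans (sSup_atoms_eq_top_iff_complementedLattice.trans ?_)⟩
  simp only [complementedLattice_iff, isCompl_iff, disjoint_iff, codisjoint_iff]
end

section
/- Let R ⊊ S be a pointwise minimal ring extension, i.e. for every x ∈ S with x ∉ (⊥ : Subalgebra R S), the subalgebra Algebra.adjoin R {x} is an atom of [R,S]. Then sSup {A ∈ [R,S] | A is an atom} = ⊤; in particular, when the extension has FCP its Loewy length equals 1. -/
/-- The atoms of `Subalgebra R S` generate `S` when every element outside `⊥` generates an atom. -/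
theorem sSup_isAtom_eq_top_of_adjoin_singleton {R S : Type*} [CommRing R] [CommRing S] [Algebra R S]
    (hpm : ∀ x : S, x ∉ (⊥ : Subalgebra R S) →
      IsAtom (Algebra.adjoin R ({x} : Set S))) :
    sSup {A : Subalgebra R S | IsAtom A} = ⊤ := by
  refine eq_top_iff.2 fun x _ => ?_
  by_cases hx : x ∈ (⊥ : Subalgebra R S)
  · exact (bot_le : ⊥ ≤ sSup {A : Subalgebra R S | IsAtom A}) hx
  · have hle : Algebra.adjoin R {x} ≤ sSup {A : Subalgebra R S | IsAtom A} := le_sSup (hpm x hx)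
    exact hle (Algebra.self_mem_adjoin_singleton R x)

theorem pointwise_minimal_socle_eq_top
    {R S : Type*} [CommRing R] [CommRing S] [Algebra R S]
    (hinj : Function.Injective (algebraMap R S))
    (hRS : (⊥ : Subalgebra R S) ≠ ⊤)
    (hpm : ∀ x : S, x ∉ (⊥ : Subalgebra R S) →
      IsAtom (Algebra.adjoin R ({x} : Set S))) :
    sSup {A : Subalgebra R S | IsAtom A} = ⊤ ∧
    (∀ n : ℕ, IsLeast {m : ℕ | loewySeries R S m = ⊤} n → n = 1) := by
  have htop := sSup_isAtom_eq_top_of_adjoin_singleton hpm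
  refine ⟨htop, fun n hn => le_antisymm (hn.2 ?_) (Nat.one_le_iff_ne_zero.2 ?_)⟩
  · simpa [loewySeries, bot_covBy_iff] using htop
  · rintro rfl
    exact hRS hn.1
end

section
/- Let R ⊊ S be an FCP ring extension with Loewy series {S_i} and Loewy length n which is a P-extension. Then the extension is distributive if and only if for every i < n the interval [S_i, S_{i+1}] of [R,S] is Boolean. If these equivalent conditions hold, then [R,S] is a finite set (the extension has FIP). -/
/-- In a distributive lattice whose chains are finite, every principal lower set is finite. -/
theorem finite_Iic_of_inf_sup_left {α : Type*} [Lattice α] [WellFoundedLT α] [WellFoundedGT α]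
    (hd : ∀ a b c : α, a ⊓ (b ⊔ c) = (a ⊓ b) ⊔ (a ⊓ c)) (v : α) : (Set.Iic v).Finite := by
  induction v using WellFoundedLT.induction with
  | ind v ih =>
    rcases (Set.Iio v).eq_empty_or_nonempty with he | hne
    · refine (Set.finite_singleton v).subset fun x hx => ?_
      by_contra hxv
      exact Set.eq_empty_iff_forall_notMem.mp he x (lt_of_le_of_ne hx hxv)
    · obtain ⟨m, hm, hmax⟩ := wellFounded_gt.has_min (Set.Iio v) hne
      by_cases hc : ∀ c < v, c ≤ m
      · refine ((ih m hm).insert v).subset fun x hx => ?_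
        rcases eq_or_lt_of_le (show x ≤ v from hx) with rfl | hlt
        · exact Set.mem_insert _ _
        · exact Set.mem_insert_of_mem _ (hc x hlt)
      · push Not at hc
        obtain ⟨c, hcv, hcm⟩ := hc
        have hsup : m ⊔ c = v := by
          by_contra hne'
          exact hmax (m ⊔ c) (lt_of_le_of_ne (sup_le hm.le hcv.le) hne') (left_lt_sup.mpr hcm)
        refine (((ih m hm).prod (ih c hcv)).image fun p : α × α => p.1 ⊔ p.2).subset
          fun x hx => ⟨(x ⊓ m, x ⊓ c), ⟨inf_le_right, inf_le_right⟩, ?_⟩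
        change (x ⊓ m) ⊔ (x ⊓ c) = x
        rw [← hd, hsup]
        exact inf_eq_left.mpr hx

/-- In a distributive complete lattice with the ascending chain condition, the interval from an
element to the join of its covers is Boolean. -/
theorem isBooleanInterval_sup_sSup_covBy {α : Type*} [CompleteLattice α] [WellFoundedGT α]
    (hd : ∀ a b c : α, a ⊓ (b ⊔ c) = (a ⊓ b) ⊔ (a ⊓ c)) (t : α) :
    IsBooleanInterval t (t ⊔ sSup {a | t ⋖ a}) := by
  refine ⟨fun a b c _ _ _ _ _ _ => hd a b c, fun v htv hvu => ?_⟩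
  obtain ⟨w, ⟨htw, hwu, hvw⟩, hmax⟩ := wellFounded_gt.has_min
    {w : α | t ≤ w ∧ w ≤ t ⊔ sSup {a | t ⋖ a} ∧ v ⊓ w = t}
    ⟨t, le_rfl, le_sup_left, inf_eq_right.mpr htv⟩
  refine ⟨w, htw, hwu, hvw, le_antisymm (sup_le hvu hwu)
    (sup_le (htv.trans le_sup_left) (sSup_le fun a ha => ?_))⟩
  rcases ha.eq_or_eq (le_inf htv ha.le) inf_le_right with h | h
  · by_contra hle
    refine hmax (w ⊔ a) ⟨htw.trans le_sup_left,
      sup_le hwu ((le_sSup ha).trans le_sup_right), ?_⟩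
      (left_lt_sup.mpr fun haw => hle (haw.trans le_sup_right))
    rw [hd, hvw, h, sup_idem]
  · exact (inf_eq_right.mp h).trans le_sup_left

/-- A lattice covered by the consecutive intervals of a monotone sequence is distributive as soon
as each of these intervals is. -/
theorem inf_sup_left_of_forall_step {α : Type*} [Lattice α] {s : ℕ → α} (hs : Monotone s) {n : ℕ}
    (hcover : ∀ x, ∃ i < n, s i ≤ x ∧ x ≤ s (i + 1))
    (hstep : ∀ i < n, ∀ a b c : α, s i ≤ a → a ≤ s (i + 1) → s i ≤ b → b ≤ s (i + 1) →
      s i ≤ c → c ≤ s (i + 1) → a ⊓ (b ⊔ c) = (a ⊓ b) ⊔ (a ⊓ c)) (a b c : α) :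
    a ⊓ (b ⊔ c) = (a ⊓ b) ⊔ (a ⊓ c) := by
  obtain ⟨i, hi, hia, hai⟩ := hcover a
  obtain ⟨j, -, hjb, hbj⟩ := hcover b
  obtain ⟨k, -, hkc, hck⟩ := hcover c
  have hle {p q : ℕ} {x y : α} (hpq : p < q) (hx : x ≤ s (p + 1)) (hy : s q ≤ y) : x ≤ y :=
    (hx.trans (hs hpq)).trans hy
  refine le_antisymm ?_ le_inf_sup
  rcases lt_trichotomy j k with h | rfl | h
  · rw [sup_eq_right.mpr (hle h hbj hkc)]
    exact le_sup_right
  · rcases lt_trichotomy i j with h | rfl | h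
    · exact inf_le_left.trans ((le_inf le_rfl (hle h hai hjb)).trans le_sup_left)
    · exact (hstep i hi a b c hia hai hjb hbj hkc hck).le
    · rw [inf_eq_right.mpr (hle h hbj hia), inf_eq_right.mpr (hle h hck hia)]
      exact inf_le_right
  · rw [sup_eq_left.mpr (hle h hck hjb)]
    exact le_sup_left

theorem pExtension_distributive_iff_boolean_steps
    {R S : Type*} [CommRing R] [CommRing S] [Algebra R S]
    (hinj : Function.Injective (algebraMap R S))
    [WellFoundedLT (Subalgebra R S)] [WellFoundedGT (Subalgebra R S)]
    (hRS : (⊥ : Subalgebra R S) ≠ ⊤)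
    (n : ℕ) (hn : IsLeast {m : ℕ | loewySeries R S m = ⊤} n)
    (hP : ∀ T : Subalgebra R S, ∃ i < n,
      loewySeries R S i ≤ T ∧ T ≤ loewySeries R S (i + 1)) :
    ((∀ a b c : Subalgebra R S, a ⊓ (b ⊔ c) = (a ⊓ b) ⊔ (a ⊓ c)) ↔
      (∀ i < n, IsBooleanInterval (loewySeries R S i) (loewySeries R S (i + 1)))) ∧
    ((∀ i < n, IsBooleanInterval (loewySeries R S i) (loewySeries R S (i + 1))) →
      Finite (Subalgebra R S)) := by
  have hdist (h : ∀ i < n, IsBooleanInterval (loewySeries R S i) (loewySeries R S (i + 1))) :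
      ∀ a b c : Subalgebra R S, a ⊓ (b ⊔ c) = (a ⊓ b) ⊔ (a ⊓ c) :=
    inf_sup_left_of_forall_step (monotone_nat_of_le_succ fun _ => le_sup_left) hP
      fun i hi => (h i hi).1
  refine ⟨⟨fun hd i _ => isBooleanInterval_sup_sSup_covBy hd _, hdist⟩, fun h => ?_⟩
  have hfin := finite_Iic_of_inf_sup_left (hdist h) ⊤
  rwa [Set.Iic_top, Set.finite_univ_iff] at hfin
end

section
/- Let R ⊊ S be a distributive FCP ring extension with Loewy series {S_i} and Loewy length n. Then the extension is a P-extension if and only if for every T ∈ [R,S] the following equivalence holds: (T ≠ ⊥ and T is join-irreducible, i.e. T = U ⊔ V implies T = U or T = V) if and only if there exists i < n with S_i ⋖ T (i.e. T is an atom of the interval [S_i, S_{i+1}]). -/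
theorem SupIrred.le_or_le_of_inf_sup {L : Type*} [Lattice L]
    (hdist : ∀ a b c : L, a ⊓ (b ⊔ c) = (a ⊓ b) ⊔ (a ⊓ c))
    {a b c : L} (ha : SupIrred a) (h : a ≤ b ⊔ c) : a ≤ b ∨ a ≤ c :=
  (ha.2 ((hdist a b c).symm.trans (inf_eq_left.2 h))).imp inf_eq_left.1 inf_eq_left.1

theorem SupIrred.exists_le_of_le_sSup {L : Type*} [CompleteLattice L] [WellFoundedGT L]
    (hdist : ∀ a b c : L, a ⊓ (b ⊔ c) = (a ⊓ b) ⊔ (a ⊓ c))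
    {a : L} (ha : SupIrred a) {s : Set L} (h : a ≤ sSup s) : ∃ b ∈ s, a ≤ b := by
  have hprime : SupPrime a := ⟨ha.1, fun _ _ => ha.le_or_le_of_inf_sup hdist⟩
  obtain ⟨t, hts, ht⟩ := CompleteLattice.WellFoundedGT.isSupFiniteCompact L s
  rw [ht] at h
  obtain ⟨b, hb, hab⟩ := hprime.le_finset_sup.1 h
  exact ⟨b, hts hb, hab⟩

theorem supIrred_iff_ne_bot {L : Type*} [Lattice L] [OrderBot L] {a : L} :
    SupIrred a ↔ a ≠ ⊥ ∧ ∀ b c, a = b ⊔ c → a = b ∨ a = c := by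
  simp only [SupIrred, isMin_iff_eq_bot, eq_comm (a := a), ne_eq]

section LoewySeries

variable {R S : Type*} [CommRing R] [CommRing S] [Algebra R S]

theorem loewySeries_succ (i : ℕ) :
    loewySeries R S (i + 1) =
      loewySeries R S i ⊔ sSup {A : Subalgebra R S | loewySeries R S i ⋖ A} :=
  rfl

theorem loewySeries_monotone : Monotone (loewySeries R S) :=
  monotone_nat_of_le_succ fun _ => le_sup_left

theorem le_loewySeries_succ_of_covBy {T : Subalgebra R S} {i : ℕ}
    (h : loewySeries R S i ⋖ T) : T ≤ loewySeries R S (i + 1) :=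
  le_sup_of_le_right (le_sSup h)

theorem loewySeries_eq_of_succ_eq {i : ℕ} (h : loewySeries R S (i + 1) = loewySeries R S i) :
    ∀ {m : ℕ}, i ≤ m → loewySeries R S m = loewySeries R S i := by
  intro m hm
  induction m, hm using Nat.le_induction with
  | base => rfl
  | succ m _ ih => rw [loewySeries_succ, ih, ← loewySeries_succ, h]

theorem loewySeries_lt_succ_s9 {n : ℕ} (hn : IsLeast {m : ℕ | loewySeries R S m = ⊤} n)
    {i : ℕ} (hi : i < n) : loewySeries R S i < loewySeries R S (i + 1) :=
  (loewySeries_monotone i.le_succ).lt_of_ne fun h =>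
    hi.not_ge (hn.2 ((loewySeries_eq_of_succ_eq h.symm hi.le).symm.trans hn.1))

/-- If `T ≠ ⊥` lies in a step of the Loewy series, it lies in a step whose bottom is strictly
below `T`. -/
theorem exists_loewySeries_lt_of_ne_bot {n : ℕ}
    (hn : IsLeast {m : ℕ | loewySeries R S m = ⊤} n) {T : Subalgebra R S} (hT : T ≠ ⊥)
    (hP : ∃ i < n, loewySeries R S i ≤ T ∧ T ≤ loewySeries R S (i + 1)) :
    ∃ i < n, loewySeries R S i < T ∧ T ≤ loewySeries R S (i + 1) := by
  obtain ⟨i, hi, hiT, hTi⟩ := hP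
  rcases hiT.lt_or_eq with hlt | rfl
  · exact ⟨i, hi, hlt, hTi⟩
  · cases i with
    | zero => exact absurd rfl hT
    | succ i => exact ⟨i, by omega, loewySeries_lt_succ_s9 hn (by omega), le_rfl⟩

theorem SupIrred.loewySeries_covBy [WellFoundedGT (Subalgebra R S)]
    (hdist : ∀ a b c : Subalgebra R S, a ⊓ (b ⊔ c) = (a ⊓ b) ⊔ (a ⊓ c))
    {T : Subalgebra R S} (hT : SupIrred T) {i : ℕ} (hlt : loewySeries R S i < T)
    (hle : T ≤ loewySeries R S (i + 1)) : loewySeries R S i ⋖ T := by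
  rcases hT.le_or_le_of_inf_sup hdist hle with h | h
  · exact absurd h hlt.not_ge
  · obtain ⟨A, hA, hTA⟩ := hT.exists_le_of_le_sSup hdist h
    have hA : loewySeries R S i ⋖ A := hA
    rcases hA.eq_or_eq hlt.le hTA with h | h
    · exact absurd h hlt.ne'
    · exact h ▸ hA

theorem supIrred_of_loewySeries_covBy
    (hP : ∀ T : Subalgebra R S, ∃ i, loewySeries R S i ≤ T ∧ T ≤ loewySeries R S (i + 1))
    {T : Subalgebra R S} {i : ℕ} (h : loewySeries R S i ⋖ T) : SupIrred T := by
  have key : ∀ U ≤ T, U ≠ T → U ≤ loewySeries R S i := by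
    intro U hUT hne
    obtain ⟨j, hjU, hUj⟩ := hP U
    rcases lt_or_ge j i with hji | hij
    · exact hUj.trans (loewySeries_monotone hji)
    · exact ((h.eq_or_eq ((loewySeries_monotone hij).trans hjU) hUT).resolve_right hne).le
  refine ⟨h.lt.not_isMin, fun U V hUV => ?_⟩
  by_contra! hne
  refine h.lt.not_ge (hUV ▸ sup_le (key U ?_ hne.1) (key V ?_ hne.2))
  · exact hUV ▸ le_sup_left
  · exact hUV ▸ le_sup_right

theorem exists_loewySeries_step [WellFoundedLT (Subalgebra R S)] {n : ℕ} (hn : 0 < n)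
    (hirr : ∀ T : Subalgebra R S, SupIrred T → ∃ i < n, loewySeries R S i ⋖ T)
    (T : Subalgebra R S) :
    ∃ i < n, loewySeries R S i ≤ T ∧ T ≤ loewySeries R S (i + 1) := by
  classical
  let k := Nat.findGreatest (fun i => loewySeries R S i ≤ T) (n - 1)
  have hk : loewySeries R S k ≤ T :=
    Nat.findGreatest_spec (P := fun i => loewySeries R S i ≤ T) (Nat.zero_le _) bot_le
  have hkn : k ≤ n - 1 := Nat.findGreatest_le _
  refine ⟨k, by omega, hk, ?_⟩
  obtain ⟨s, hs, hirr_s⟩ := exists_supIrred_decomposition T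
  rw [← hs]
  refine Finset.sup_le fun p hp => ?_
  obtain ⟨j, hj, hjp⟩ := hirr p (hirr_s hp)
  have hpT : p ≤ T := hs ▸ Finset.le_sup (f := id) hp
  have hjk : j ≤ k := Nat.le_findGreatest (by omega) (hjp.le.trans hpT)
  exact (le_loewySeries_succ_of_covBy hjp).trans (loewySeries_monotone (by omega))

end LoewySeries

theorem pExtension_iff_joinIrreducible_are_atoms_of_steps
    {R S : Type*} [CommRing R] [CommRing S] [Algebra R S]
    (hinj : Function.Injective (algebraMap R S))
    [WellFoundedLT (Subalgebra R S)] [WellFoundedGT (Subalgebra R S)]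
    (hRS : (⊥ : Subalgebra R S) ≠ ⊤)
    (hdist : ∀ a b c : Subalgebra R S, a ⊓ (b ⊔ c) = (a ⊓ b) ⊔ (a ⊓ c))
    (n : ℕ) (hn : IsLeast {m : ℕ | loewySeries R S m = ⊤} n) :
    (∀ T : Subalgebra R S, ∃ i < n,
        loewySeries R S i ≤ T ∧ T ≤ loewySeries R S (i + 1)) ↔
      (∀ T : Subalgebra R S,
        ((T ≠ ⊥ ∧ ∀ U V : Subalgebra R S, T = U ⊔ V → T = U ∨ T = V) ↔
          ∃ i < n, loewySeries R S i ⋖ T)) := by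
  simp only [← supIrred_iff_ne_bot]
  constructor
  · refine fun hP T => ⟨fun hT => ?_, fun ⟨i, _, hi⟩ => ?_⟩
    · obtain ⟨i, hi, hlt, hle⟩ := exists_loewySeries_lt_of_ne_bot hn hT.ne_bot (hP T)
      exact ⟨i, hi, hT.loewySeries_covBy hdist hlt hle⟩
    · exact supIrred_of_loewySeries_covBy (fun U => (hP U).imp fun _ h => h.2) hi
  · have hpos : 0 < n := Nat.pos_of_ne_zero fun h => hRS (h ▸ hn.1 : loewySeries R S 0 = ⊤)
    exact fun h => exists_loewySeries_step hpos fun T => (h T).1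
end

section
/- Let R be a commutative ring and M an R-module of finite length, and let S := TrivSqZeroExt R M be the idealization of M in R (so R embeds in S via r ↦ (r,0)). Let {S_i} be the Loewy series of the lattice Subalgebra R S and let {M_i} be the Loewy series of the lattice Submodule R M (M_0 = ⊥ and M_{i+1} = M_i ⊔ sSup {N : Submodule R M | M_i ⋖ N}). Then for every i, an element x : TrivSqZeroExt R M belongs to S_i if and only if its second component x.snd belongs to M_i; in particular the Loewy length of the extension R ⊆ S equals the Loewy length of the module M (the least n with M_n = ⊤). -/
/-- The Loewy series of the lattice of submodules of an `R`-module `M`: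
`M_0 = ⊥` and `M_{i+1} = M_i ⊔ sSup {N | M_i ⋖ N}`. -/
noncomputable def loewySeriesMod (R M : Type*) [CommRing R] [AddCommGroup M]
    [Module R M] : ℕ → Submodule R M
  | 0 => ⊥
  | n + 1 => loewySeriesMod R M n ⊔ sSup {N : Submodule R M | loewySeriesMod R M n ⋖ N}

namespace TrivSqZeroExt

variable (R M : Type*) [CommRing R] [AddCommGroup M] [Module R M]
  [Module Rᵐᵒᵖ M] [IsCentralScalar R M]

/-- Submodules of `M` correspond to `R`-subalgebras of the idealization of `M`, a submodule `N`
being sent to the subalgebra of all `x` with `x.snd ∈ N`. -/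
def submoduleOrderIsoSubalgebra : Submodule R M ≃o Subalgebra R (TrivSqZeroExt R M) where
  toFun N :=
    { carrier := {x | x.snd ∈ N}
      mul_mem' := fun {x y} hx hy => by
        simpa using N.add_mem (N.smul_mem x.fst hy) (N.smul_mem y.fst hx)
      add_mem' := fun hx hy => N.add_mem hx hy
      algebraMap_mem' := fun r => N.zero_mem }
  invFun A := (Subalgebra.toSubmodule A).comap (inrHom R M)
  left_inv N := by
    ext m
    rfl
  right_inv A := by
    ext x
    change inr x.snd ∈ A ↔ x ∈ A
    have hinl : inl x.fst ∈ A := A.algebraMap_mem x.fst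
    conv_rhs => rw [← inl_fst_add_inr_snd_eq x]
    exact (add_mem_cancel_left hinl).symm
  map_rel_iff' {N P} := ⟨fun h m hm => h (show (inr m : TrivSqZeroExt R M).snd ∈ N from hm),
    fun h _ hx => h hx⟩

variable {R M}

theorem mem_submoduleOrderIsoSubalgebra {N : Submodule R M} {x : TrivSqZeroExt R M} :
    x ∈ submoduleOrderIsoSubalgebra R M N ↔ x.snd ∈ N :=
  Iff.rfl

end TrivSqZeroExt

/-- An order isomorphism commutes with taking the join of all covers of an element. -/
theorem OrderIso.map_sSup_covBy {α β : Type*} [CompleteLattice α] [CompleteLattice β]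
    (e : α ≃o β) (a : α) : e (sSup {b | a ⋖ b}) = sSup {b | e a ⋖ b} := by
  rw [e.map_sSup_eq_sSup_symm_preimage]
  congr 1
  ext b
  rw [Set.mem_preimage, Set.mem_ofPred_eq, Set.mem_ofPred_eq, ← apply_covBy_apply_iff e,
    e.apply_symm_apply]

theorem submoduleOrderIsoSubalgebra_loewySeriesMod (R M : Type*) [CommRing R] [AddCommGroup M]
    [Module R M] [Module Rᵐᵒᵖ M] [IsCentralScalar R M] (i : ℕ) :
    TrivSqZeroExt.submoduleOrderIsoSubalgebra R M (loewySeriesMod R M i) =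
      loewySeries R (TrivSqZeroExt R M) i := by
  induction i with
  | zero => exact OrderIso.map_bot _
  | succ n ih => rw [loewySeriesMod, loewySeries, OrderIso.map_sup, OrderIso.map_sSup_covBy, ih]

theorem loewySeries_idealization
    {R M : Type*} [CommRing R] [AddCommGroup M] [Module R M]
    [Module Rᵐᵒᵖ M] [IsCentralScalar R M]
    (hM : IsFiniteLength R M) :
    (∀ i : ℕ, ∀ x : TrivSqZeroExt R M,
        x ∈ loewySeries R (TrivSqZeroExt R M) i ↔ x.snd ∈ loewySeriesMod R M i) ∧
    (∀ n : ℕ, IsLeast {m : ℕ | loewySeries R (TrivSqZeroExt R M) m = ⊤} n ↔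
        IsLeast {m : ℕ | loewySeriesMod R M m = ⊤} n) := by
  simp only [← submoduleOrderIsoSubalgebra_loewySeriesMod, map_eq_top_iff,
    TrivSqZeroExt.mem_submoduleOrderIsoSubalgebra, implies_true, and_self]
end

section
/- Let k ⊆ L be a finite Galois field extension. Then the lattice IntermediateField k L is distributive if and only if the Galois group L ≃ₐ[k] L is cyclic. -/
open Subgroup

theorem Nat.gcd_lcm_distrib {n r s : ℕ} (hn : n ≠ 0) (hr : r ≠ 0) (hs : s ≠ 0) :
    n.gcd (r.lcm s) = (n.gcd r).lcm (n.gcd s) := by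
  have hnr := Nat.gcd_ne_zero_left (n := r) hn
  have hns := Nat.gcd_ne_zero_left (n := s) hn
  apply Nat.eq_of_factorization_eq (Nat.gcd_ne_zero_left hn) (Nat.lcm_ne_zero hnr hns)
  intro p
  rw [Nat.factorization_gcd hn (Nat.lcm_ne_zero hr hs), Nat.factorization_lcm hr hs,
    Nat.factorization_lcm hnr hns, Nat.factorization_gcd hn hr, Nat.factorization_gcd hn hs]
  exact inf_sup_left _ _ _

theorem IsCyclic.mem_of_orderOf_dvd_card {G : Type*} [Group G] [Finite G] [IsCyclic G]
    {K : Subgroup G} {x : G} (h : orderOf x ∣ Nat.card K) : x ∈ K := by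
  classical
  have := Fintype.ofFinite G
  have hK : (K : Set G).toFinset ⊆ Finset.univ.filter (fun y : G => y ^ Nat.card K = 1) := by
    intro y hy
    simp only [Set.mem_toFinset, SetLike.mem_coe] at hy
    simpa using orderOf_dvd_iff_pow_eq_one.mp (K.orderOf_dvd_natCard hy)
  have hcard : (K : Set G).toFinset.card = Nat.card K := by
    rw [Set.toFinset_card, ← Nat.card_eq_fintype_card]; rfl
  have heq := Finset.eq_of_subset_of_card_le hK
    ((IsCyclic.card_pow_eq_one_le Nat.card_pos).trans_eq hcard.symm)
  have hx : x ∈ (K : Set G).toFinset := by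
    rw [heq]; simpa using orderOf_dvd_iff_pow_eq_one.mp h
  simpa using hx

theorem IsCyclic.subgroup_inf_sup_le {G : Type*} [Group G] [Finite G] [IsCyclic G]
    (A B C : Subgroup G) : A ⊓ (B ⊔ C) ≤ (A ⊓ B) ⊔ (A ⊓ C) := by
  let _ : CommGroup G := IsCyclic.commGroup
  rintro x ⟨hxA, hx⟩
  have key : ∀ {D : Subgroup G} {y : G}, y ∈ D →
      (orderOf x).gcd (orderOf y) ∣ Nat.card (A ⊓ D : Subgroup G) := by
    intro D y hy
    have hdvd : (orderOf x).gcd (orderOf y) ∣ orderOf y := Nat.gcd_dvd_right _ _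
    have ho := orderOf_pow_orderOf_div (orderOf_pos y).ne' hdvd
    rw [← ho]
    refine Subgroup.orderOf_dvd_natCard _ ⟨?_, pow_mem hy _⟩
    refine IsCyclic.mem_of_orderOf_dvd_card ?_
    rw [ho]
    exact (Nat.gcd_dvd_left _ _).trans (Subgroup.orderOf_dvd_natCard A hxA)
  obtain ⟨b, hb, c, hc, rfl⟩ := Subgroup.mem_sup.mp hx
  apply IsCyclic.mem_of_orderOf_dvd_card
  have hlcm : orderOf (b * c) ∣ (orderOf b).lcm (orderOf c) :=
    (Commute.all b c).orderOf_mul_dvd_lcm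
  rw [← Nat.gcd_eq_left hlcm, Nat.gcd_lcm_distrib (orderOf_pos _).ne' (orderOf_pos _).ne'
    (orderOf_pos _).ne']
  exact Nat.lcm_dvd ((key hb).trans (card_dvd_of_le le_sup_left))
    ((key hc).trans (card_dvd_of_le le_sup_right))

namespace Subgroup

variable {G : Type*} [Group G]

/-- In a distributive subgroup lattice, the cyclic subgroup of `a` is recovered from its
intersections with those of `b` and `a * b`. -/
theorem zpowers_le_inf_sup_inf (h : ∀ A B C : Subgroup G, A ⊓ (B ⊔ C) ≤ (A ⊓ B) ⊔ (A ⊓ C))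
    (a b : G) :
    zpowers a ≤ (zpowers a ⊓ zpowers b) ⊔ (zpowers a ⊓ zpowers (a * b)) := by
  refine le_trans (le_inf le_rfl ?_) (h _ _ _)
  rw [zpowers_le]
  have hb : b ∈ zpowers b ⊔ zpowers (a * b) := mem_sup_left (mem_zpowers b)
  have hab : a * b ∈ zpowers b ⊔ zpowers (a * b) := mem_sup_right (mem_zpowers _)
  simpa using mul_mem hab (inv_mem hb)

theorem commute_of_inf_sup_le (h : ∀ A B C : Subgroup G, A ⊓ (B ⊔ C) ≤ (A ⊓ B) ⊔ (A ⊓ C))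
    (a b : G) : Commute a b := by
  have hle : (zpowers a ⊓ zpowers b) ⊔ (zpowers a ⊓ zpowers (a * b)) ≤ centralizer {b} := by
    refine sup_le ?_ ?_
    · rintro x ⟨-, hx⟩
      obtain ⟨n, rfl⟩ := mem_zpowers_iff.mp hx
      exact mem_centralizer_singleton_iff.mpr ((Commute.refl b).zpow_left n)
    · rintro x ⟨hx, hx'⟩
      obtain ⟨n, rfl⟩ := mem_zpowers_iff.mp hx
      obtain ⟨m, hm⟩ := mem_zpowers_iff.mp hx'
      have h₁ : Commute (a ^ n) a⁻¹ := ((Commute.refl a).zpow_left n).inv_right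
      have h₂ : Commute (a ^ n) (a * b) := hm ▸ (Commute.refl (a * b)).zpow_left m
      have h₃ := h₁.mul_right h₂
      rw [inv_mul_cancel_left] at h₃
      exact mem_centralizer_singleton_iff.mpr h₃
  exact mem_centralizer_singleton_iff.mp
    (hle (zpowers_le_inf_sup_inf h a b (mem_zpowers a)))

theorem zpowers_inf_zpowers_eq_bot {p : ℕ} [Fact p.Prime] {x y : G}
    (hy : y ^ p = 1) (hxy : y ∉ zpowers x) : zpowers x ⊓ zpowers y = ⊥ := by
  rw [eq_bot_iff]
  rintro z ⟨hzx, hzy⟩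
  by_contra hz
  have hy1 : y ≠ 1 := fun h => hxy (h ▸ one_mem _)
  have hcard : Nat.card (zpowers y) = p := by
    rw [Nat.card_zpowers, orderOf_eq_prime hy hy1]
  have hmem : (⟨y, mem_zpowers y⟩ : zpowers y) ∈ zpowers (⟨z, hzy⟩ : zpowers y) :=
    mem_zpowers_of_prime_card hcard (fun h => hz (by simpa using congrArg Subtype.val h))
  obtain ⟨n, hn⟩ := mem_zpowers_iff.mp hmem
  have hn' : z ^ n = y := by simpa using congrArg Subtype.val hn
  exact hxy (hn' ▸ Subgroup.zpow_mem _ hzx n)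

theorem mem_zpowers_of_pow_prime_eq_one
    (h : ∀ A B C : Subgroup G, A ⊓ (B ⊔ C) ≤ (A ⊓ B) ⊔ (A ⊓ C))
    {p : ℕ} [Fact p.Prime] {a b : G} (ha : a ^ p = 1) (hb : b ^ p = 1) (ha1 : a ≠ 1) :
    b ∈ zpowers a := by
  by_contra hba
  have hab : a * b ∉ zpowers a := fun hm => hba <| by
    simpa using mul_mem (inv_mem (mem_zpowers a)) hm
  have habp : (a * b) ^ p = 1 := by
    rw [(commute_of_inf_sup_le h a b).mul_pow, ha, hb, one_mul]
  have hle := zpowers_le_inf_sup_inf h a b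
  rw [zpowers_inf_zpowers_eq_bot hb hba, zpowers_inf_zpowers_eq_bot habp hab, sup_bot_eq,
    le_bot_iff, zpowers_eq_bot] at hle
  exact ha1 hle

theorem card_pow_prime_eq_one_le [Fintype G] [DecidableEq G]
    (h : ∀ A B C : Subgroup G, A ⊓ (B ⊔ C) ≤ (A ⊓ B) ⊔ (A ⊓ C)) {p : ℕ} (hp : p.Prime) :
    (Finset.univ.filter (fun x : G => x ^ p = 1)).card ≤ p := by
  classical
  have : Fact p.Prime := ⟨hp⟩
  by_cases hex : ∃ a : G, a ^ p = 1 ∧ a ≠ 1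
  · obtain ⟨a, ha, ha1⟩ := hex
    calc (Finset.univ.filter (fun x : G => x ^ p = 1)).card
        ≤ (zpowers a : Set G).toFinset.card := Finset.card_le_card fun b hb => by
          simpa using mem_zpowers_of_pow_prime_eq_one h ha (Finset.mem_filter.mp hb).2 ha1
      _ = p := by
        rw [← Set.ncard_eq_toFinset_card', ← Nat.card_coe_set_eq]
        exact (Nat.card_zpowers a).trans (orderOf_eq_prime ha ha1)
  · push Not at hex
    calc (Finset.univ.filter (fun x : G => x ^ p = 1)).card
        ≤ ({1} : Finset G).card := Finset.card_le_card fun b hb => by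
          simpa using hex b (by simpa using hb)
      _ ≤ p := by simpa using hp.one_le

theorem card_pow_eq_one_le_of_inf_sup_le [Fintype G] [DecidableEq G]
    (h : ∀ A B C : Subgroup G, A ⊓ (B ⊔ C) ≤ (A ⊓ B) ⊔ (A ⊓ C)) {n : ℕ} (hn : 0 < n) :
    (Finset.univ.filter (fun x : G => x ^ n = 1)).card ≤ n := by
  induction n using induction_on_primes with
  | zero => exact absurd hn (lt_irrefl 0)
  | one => simp [Finset.filter_eq']
  | prime_mul p n hp ih =>
    have hn' : 0 < n := pos_of_mul_pos_right hn (Nat.zero_le p)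
    have hmaps : ∀ x ∈ Finset.univ.filter (fun x : G => x ^ (p * n) = 1),
        x ^ n ∈ Finset.univ.filter (fun x : G => x ^ p = 1) := by
      intro x hx
      simpa [← pow_mul, mul_comm n p] using hx
    have hfib : ∀ y ∈ Finset.univ.filter (fun x : G => x ^ p = 1),
        ((Finset.univ.filter (fun x : G => x ^ (p * n) = 1)).filter
          (fun x => x ^ n = y)).card ≤ n := by
      intro y _
      rcases Finset.eq_empty_or_nonempty ((Finset.univ.filter
        (fun x : G => x ^ (p * n) = 1)).filter (fun x => x ^ n = y)) with he | ⟨z, hz⟩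
      · simp [he]
      · refine le_trans (Finset.card_le_card_of_injOn (fun x => x * z⁻¹) ?_
          (mul_left_injective z⁻¹).injOn) (ih hn')
        intro x hx
        simp only [Finset.coe_filter, Finset.mem_filter, Finset.mem_univ, true_and,
          Set.mem_ofPred_eq] at hx hz ⊢
        rw [(commute_of_inf_sup_le h x z⁻¹).mul_pow, inv_pow, hx.2, hz.2, mul_inv_cancel]
    calc _ ≤ n * (Finset.univ.filter (fun x : G => x ^ p = 1)).card :=
          Finset.card_le_mul_card_image_of_maps_to hmaps n hfib
      _ ≤ n * p := Nat.mul_le_mul_left n (card_pow_prime_eq_one_le h hp)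
      _ = p * n := mul_comm n p

/-- **Ore's theorem** for finite groups. -/
theorem inf_sup_le_iff_isCyclic [Finite G] :
    (∀ A B C : Subgroup G, A ⊓ (B ⊔ C) ≤ (A ⊓ B) ⊔ (A ⊓ C)) ↔ IsCyclic G := by
  classical
  have := Fintype.ofFinite G
  exact ⟨fun h => isCyclic_of_card_pow_eq_one_le fun _ => card_pow_eq_one_le_of_inf_sup_le h,
    fun _ => IsCyclic.subgroup_inf_sup_le⟩

end Subgroup

theorem OrderIso.inf_sup_le_of_dual {α β : Type*} [Lattice α] [Lattice β] (e : α ≃o βᵒᵈ)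
    (h : ∀ a b c : α, a ⊓ (b ⊔ c) ≤ (a ⊓ b) ⊔ (a ⊓ c)) (x y z : β) :
    x ⊓ (y ⊔ z) ≤ (x ⊓ y) ⊔ (x ⊓ z) := by
  let _ : DistribLattice α := DistribLattice.ofInfSupLe h
  have hdual : e.symm (OrderDual.toDual (x ⊓ (y ⊔ z))) =
      e.symm (OrderDual.toDual ((x ⊓ y) ⊔ (x ⊓ z))) := by
    simp only [toDual_inf, toDual_sup, map_inf, map_sup, sup_inf_left]
  exact (OrderDual.toDual.injective (e.symm.injective hdual)).le

theorem galois_distributive_iff_cyclic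
    {k L : Type*} [Field k] [Field L] [Algebra k L]
    [FiniteDimensional k L] [IsGalois k L] :
    (∀ a b c : IntermediateField k L, a ⊓ (b ⊔ c) = (a ⊓ b) ⊔ (a ⊓ c)) ↔
      IsCyclic (L ≃ₐ[k] L) := by
  let e : IntermediateField k L ≃o (Subgroup (L ≃ₐ[k] L))ᵒᵈ :=
    IsGalois.intermediateFieldEquivSubgroup
  rw [← Subgroup.inf_sup_le_iff_isCyclic]
  refine ⟨fun h => e.inf_sup_le_of_dual fun a b c => (h a b c).le, fun h a b c => ?_⟩
  exact (OrderIso.inf_sup_le_of_dual e.dual.symm h a b c).antisymm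
    le_inf_sup
end

section
/- Let k ⊊ L be a finite Galois field extension whose Galois group L ≃ₐ[k] L is cyclic, and set n := Module.finrank k L. Then: (1) an intermediate field T ∈ [k,L] is an atom of [k,L] if and only if Module.finrank k T is a prime number, and for every prime p dividing n there is exactly one atom T with Module.finrank k T = p; (2) the socle sSup {A ∈ [k,L] | A is an atom} has degree ∏_{p ∈ n.primeFactors} p over k. -/
/-- In a finite cyclic group, a subgroup whose order divides that of another is contained in it. -/
theorem IsCyclic.subgroup_le_of_card_dvd {G : Type*} [Group G] [Finite G] [IsCyclic G]
    {H K : Subgroup G} (h : Nat.card H ∣ Nat.card K) : H ≤ K := by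
  classical
  have := Fintype.ofFinite G
  have hK : (K : Set G).toFinset = Finset.univ.filter fun x : G => x ^ Nat.card K = 1 := by
    apply Finset.eq_of_subset_of_card_le
    · intro x hx
      have hx' : x ∈ K := by simpa using hx
      simpa using orderOf_dvd_iff_pow_eq_one.1 (K.orderOf_dvd_natCard hx')
    · refine (IsCyclic.card_pow_eq_one_le Nat.card_pos).trans ?_
      simp [Nat.card_eq_fintype_card]
  intro x hx
  have hxK : x ∈ (K : Set G).toFinset := by
    rw [hK, Finset.mem_filter]
    obtain ⟨c, hc⟩ := h
    refine ⟨Finset.mem_univ x, ?_⟩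
    rw [hc, pow_mul, orderOf_dvd_iff_pow_eq_one.1 (H.orderOf_dvd_natCard hx), one_pow]
  simpa using hxK

/-- A finite cyclic group has a subgroup of every index dividing its order. -/
theorem IsCyclic.exists_subgroup_index_eq {G : Type*} [Group G] [Finite G] [IsCyclic G]
    {d : ℕ} (hd : d ∣ Nat.card G) : ∃ H : Subgroup G, H.index = d := by
  obtain ⟨g, hg⟩ := IsCyclic.exists_ofOrder_eq_natCard (α := G)
  refine ⟨Subgroup.zpowers (g ^ d), ?_⟩
  have hcard : Nat.card (Subgroup.zpowers (g ^ d)) = Nat.card G / d := by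
    rw [Nat.card_zpowers, orderOf_pow, hg, Nat.gcd_eq_right hd]
  apply Nat.eq_of_mul_eq_mul_left (Nat.card_pos (α := Subgroup.zpowers (g ^ d)))
  rw [Subgroup.card_mul_index, hcard, Nat.div_mul_cancel hd]

namespace IntermediateField

variable {k L : Type*} [Field k] [Field L] [Algebra k L]
  [FiniteDimensional k L] [IsGalois k L] [IsCyclic (L ≃ₐ[k] L)]

/-- In a finite cyclic extension, an intermediate field whose degree divides that of another is
contained in it. -/
theorem le_of_finrank_dvd_of_isCyclic {S T : IntermediateField k L}
    (h : Module.finrank k S ∣ Module.finrank k T) : S ≤ T := by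
  have hle : T.fixingSubgroup ≤ S.fixingSubgroup := by
    apply IsCyclic.subgroup_le_of_card_dvd
    obtain ⟨c, hc⟩ := h
    rw [IsGalois.card_fixingSubgroup_eq_finrank, IsGalois.card_fixingSubgroup_eq_finrank]
    refine ⟨c, Nat.eq_of_mul_eq_mul_left (Module.finrank_pos (R := k) (M := S)) ?_⟩
    rw [Module.finrank_mul_finrank, ← Module.finrank_mul_finrank k T L, hc]
    ring
  rw [← IsGalois.fixedField_fixingSubgroup S, ← IsGalois.fixedField_fixingSubgroup T]
  exact fixedField_le hle

/-- A finite cyclic extension has an intermediate field of every degree dividing its degree. -/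
theorem exists_finrank_eq_of_isCyclic {d : ℕ} (hd : d ∣ Module.finrank k L) :
    ∃ T : IntermediateField k L, Module.finrank k T = d := by
  rw [← IsGalois.card_aut_eq_finrank] at hd
  obtain ⟨H, hH⟩ := IsCyclic.exists_subgroup_index_eq hd
  refine ⟨fixedField H, ?_⟩
  rw [finrank_eq_fixingSubgroup_index, fixingSubgroup_fixedField, hH]

/-- The atoms of the lattice of a finite cyclic extension are the subfields of prime degree. -/
theorem isAtom_iff_prime_finrank_of_isCyclic (T : IntermediateField k L) :
    IsAtom T ↔ Nat.Prime (Module.finrank k T) := by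
  constructor
  · intro hT
    have hT1 : Module.finrank k T ≠ 1 := fun h => hT.1 (finrank_eq_one_iff.1 h)
    have hdvd := Nat.minFac_dvd (Module.finrank k T)
    have hp := Nat.minFac_prime hT1
    obtain ⟨S, hS⟩ := exists_finrank_eq_of_isCyclic (k := k) (L := L)
      (hdvd.trans (Dvd.intro _ (Module.finrank_mul_finrank k T L)))
    rw [← hS] at hdvd hp
    rcases hT.le_iff.1 (le_of_finrank_dvd_of_isCyclic hdvd) with h | h
    · exact absurd (finrank_eq_one_iff.2 h) hp.ne_one
    · rwa [h] at hp
  · refine fun hp => ⟨fun h => hp.ne_one (finrank_eq_one_iff.2 h), fun S hS => ?_⟩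
    rcases (Nat.dvd_prime hp).1 (finrank_dvd_of_le_right hS.le) with h | h
    · exact finrank_eq_one_iff.1 h
    · exact absurd (eq_of_le_of_finrank_eq hS.le h) hS.ne

end IntermediateField

open IntermediateField in
theorem cyclic_galois_atoms_and_socle
    {k L : Type*} [Field k] [Field L] [Algebra k L]
    [FiniteDimensional k L] [IsGalois k L] [IsCyclic (L ≃ₐ[k] L)]
    (hkL : (⊥ : IntermediateField k L) ≠ ⊤) :
    (∀ T : IntermediateField k L, IsAtom T ↔ Nat.Prime (Module.finrank k T)) ∧
    (∀ p : ℕ, p.Prime → p ∣ Module.finrank k L →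
      ∃! T : IntermediateField k L, IsAtom T ∧ Module.finrank k T = p) ∧
    Module.finrank k ↥(sSup {A : IntermediateField k L | IsAtom A}) =
      ∏ p ∈ (Module.finrank k L).primeFactors, p := by
  refine ⟨isAtom_iff_prime_finrank_of_isCyclic, fun p hp hpn => ?_, ?_⟩
  · obtain ⟨T, hT⟩ := exists_finrank_eq_of_isCyclic hpn
    refine ⟨T, ⟨(isAtom_iff_prime_finrank_of_isCyclic T).2 (hT ▸ hp), hT⟩, ?_⟩
    rintro S ⟨-, hS⟩
    exact le_antisymm (le_of_finrank_dvd_of_isCyclic (by rw [hS, hT]))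
      (le_of_finrank_dvd_of_isCyclic (by rw [hS, hT]))
  · obtain ⟨S, hS⟩ := exists_finrank_eq_of_isCyclic (k := k) (L := L)
      (Nat.prod_primeFactors_dvd (Module.finrank k L))
    rw [← hS]
    suffices h : sSup {A : IntermediateField k L | IsAtom A} = S by rw [h]
    apply le_antisymm
    · refine sSup_le fun A hA => le_of_finrank_dvd_of_isCyclic ?_
      rw [hS]
      exact Finset.dvd_prod_of_mem (fun p => p) (Nat.mem_primeFactors.2
        ⟨(isAtom_iff_prime_finrank_of_isCyclic A).1 hA,
          Dvd.intro _ (Module.finrank_mul_finrank k A L), Module.finrank_pos.ne'⟩)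
    · apply le_of_finrank_dvd_of_isCyclic
      rw [hS]
      refine Finset.prod_primes_dvd _ (fun p hp => (Nat.prime_of_mem_primeFactors hp).prime)
        fun p hp => ?_
      obtain ⟨T, hT⟩ := exists_finrank_eq_of_isCyclic (Nat.dvd_of_mem_primeFactors hp)
      rw [← hT]
      refine finrank_dvd_of_le_right (le_sSup ?_)
      exact (isAtom_iff_prime_finrank_of_isCyclic T).2 (hT ▸ Nat.prime_of_mem_primeFactors hp)
end

section
/- Let k ⊆ L be a finite-dimensional purely inseparable field extension, where p is a prime and k has characteristic p. Then the socle of [k,L] is the intermediate field of p-th roots of elements of k: for every x ∈ L, x belongs to sSup {A ∈ [k,L] | A is an atom} if and only if x^p belongs to ⊥ (i.e. x^p lies in the image of k in L). -/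
/-- The intermediate field of all `p`-th roots in `L` of elements of `k`. -/
def IntermediateField.pthRoots (k L : Type*) [Field k] [Field L] [Algebra k L]
    (p : ℕ) [ExpChar L p] : IntermediateField k L where
  carrier := {x | x ^ p ∈ (⊥ : IntermediateField k L)}
  mul_mem' {x y} hx hy := by
    simpa only [Set.mem_ofPred_eq, mul_pow] using mul_mem hx hy
  add_mem' {x y} hx hy := by
    simpa only [Set.mem_ofPred_eq, add_pow_expChar] using add_mem hx hy
  algebraMap_mem' r := by
    simpa only [Set.mem_ofPred_eq] using pow_mem (algebraMap_mem ⊥ r) p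
  inv_mem' x hx := by
    simpa only [Set.mem_ofPred_eq, inv_pow] using inv_mem hx

theorem IntermediateField.mem_pthRoots {k L : Type*} [Field k] [Field L] [Algebra k L]
    {p : ℕ} [ExpChar L p] {x : L} :
    x ∈ pthRoots k L p ↔ x ^ p ∈ (⊥ : IntermediateField k L) :=
  Set.mem_ofPred

/-- An element of a purely inseparable extension outside the base field has an iterated `p`-th
power outside the base field whose `p`-th power lies in the base field. -/
theorem IsPurelyInseparable.exists_pow_notMem_bot {k L : Type*} [Field k] [Field L] [Algebra k L]
    [IsPurelyInseparable k L] (p : ℕ) [ExpChar k p] {a : L}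
    (ha : a ∉ (⊥ : IntermediateField k L)) :
    ∃ n : ℕ, a ^ p ^ n ∉ (⊥ : IntermediateField k L) ∧
      (a ^ p ^ n) ^ p ∈ (⊥ : IntermediateField k L) := by
  classical
  have h : ∃ n : ℕ, a ^ p ^ n ∈ (⊥ : IntermediateField k L) :=
    IsPurelyInseparable.pow_mem k p a
  obtain ⟨m, hm⟩ : ∃ m, Nat.find h = m + 1 :=
    Nat.exists_eq_succ_of_ne_zero fun h0 => ha (by simpa [h0] using Nat.find_spec h)
  refine ⟨m, Nat.find_min h (by lia), ?_⟩
  rw [← pow_mul, ← pow_succ, ← hm]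
  exact Nat.find_spec h

theorem IntermediateField.le_pthRoots_of_isAtom {k L : Type*} [Field k] [Field L] [Algebra k L]
    [IsPurelyInseparable k L] (p : ℕ) [ExpChar k p] [ExpChar L p] {A : IntermediateField k L}
    (hA : IsAtom A) : A ≤ pthRoots k L p := by
  obtain ⟨a, haA, ha⟩ := SetLike.exists_of_lt hA.bot_lt
  obtain ⟨n, hn, hn'⟩ := IsPurelyInseparable.exists_pow_notMem_bot p ha
  refine inf_eq_left.mp ((hA.le_iff.mp inf_le_left).resolve_left fun h => hn ?_)
  rw [← h]
  exact ⟨pow_mem haA _, mem_pthRoots.mpr hn'⟩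

theorem IntermediateField.isAtom_of_finrank_prime {k L : Type*} [Field k] [Field L] [Algebra k L]
    {A : IntermediateField k L} (hA : (Module.finrank k A).Prime) : IsAtom A := by
  have : FiniteDimensional k A := Module.finite_of_finrank_pos hA.pos
  refine ⟨fun h => hA.ne_one (by rw [h, IntermediateField.finrank_bot]), fun B hB => ?_⟩
  rcases hA.eq_one_or_self_of_dvd _ (finrank_dvd_of_le_right hB.le) with h | h
  · exact finrank_eq_one_iff.mp h
  · exact absurd (eq_of_le_of_finrank_eq hB.le h) hB.ne

theorem IntermediateField.isAtom_adjoin_simple_of_pow_mem_bot {k L : Type*} [Field k] [Field L]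
    [Algebra k L] {p : ℕ} (hp : p.Prime) [ExpChar L p] {x : L}
    (hx : x ∉ (⊥ : IntermediateField k L)) (hxp : x ^ p ∈ (⊥ : IntermediateField k L)) :
    IsAtom (adjoin k {x}) := by
  obtain ⟨a, ha⟩ := mem_bot.mp hxp
  have hirr : Irreducible (Polynomial.X ^ p - Polynomial.C a) := by
    refine X_pow_sub_C_irreducible_of_prime hp fun b hb => hx (mem_bot.mpr ⟨b, ?_⟩)
    apply frobenius_inj L p
    simp only [frobenius_def, ← map_pow, hb, ha]
  have hmonic := Polynomial.monic_X_pow_sub_C a hp.ne_zero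
  have hroot : Polynomial.aeval x (Polynomial.X ^ p - Polynomial.C a) = 0 := by simp [ha]
  apply isAtom_of_finrank_prime
  rwa [adjoin.finrank ⟨_, hmonic, hroot⟩,
    ← minpoly.eq_of_irreducible_of_monic hirr hroot hmonic, Polynomial.natDegree_X_pow_sub_C]

theorem socle_purelyInseparable_eq_pth_roots
    {k L : Type*} [Field k] [Field L] [Algebra k L]
    [FiniteDimensional k L] [IsPurelyInseparable k L]
    (p : ℕ) (hp : p.Prime) [CharP k p] :
    ∀ x : L, x ∈ sSup {A : IntermediateField k L | IsAtom A} ↔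
      x ^ p ∈ (⊥ : IntermediateField k L) := by
  intro x
  have : ExpChar k p := ExpChar.prime hp
  have : ExpChar L p := expChar_of_injective_algebraMap (algebraMap k L).injective p
  constructor
  · intro hx
    exact IntermediateField.mem_pthRoots.mp
      (sSup_le (fun A hA => IntermediateField.le_pthRoots_of_isAtom p hA) hx)
  · intro hxp
    by_cases hx : x ∈ (⊥ : IntermediateField k L)
    · exact (bot_le : ⊥ ≤ sSup {A : IntermediateField k L | IsAtom A}) hx
    · exact le_sSup (a := IntermediateField.adjoin k {x})
        (IntermediateField.isAtom_adjoin_simple_of_pow_mem_bot hp hx hxp)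
        (IntermediateField.mem_adjoin_simple_self k x)
end

section
/- Let k ⊆ L be a finite-dimensional purely inseparable field extension. Then the following are equivalent: (1) [k,L] is a chain, i.e. any two intermediate fields are comparable; (2) the lattice IntermediateField k L is distributive; (3) there are only finitely many intermediate fields of k ⊆ L. -/
open Polynomial IntermediateField

/-- An intermediate field of prime degree over the base is an atom. -/
theorem IntermediateField.isAtom_of_finrank_prime_s17 {F E : Type*} [Field F] [Field E] [Algebra F E]
    {K : IntermediateField F E} (hK : (Module.finrank F K).Prime) : IsAtom K := by
  refine ⟨fun h => hK.ne_one (finrank_eq_one_iff.mpr h), fun M hM => ?_⟩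
  have : FiniteDimensional F K := FiniteDimensional.of_finrank_pos hK.pos
  rcases (Nat.dvd_prime hK).mp (finrank_dvd_of_le_right hM.le) with h | h
  · exact finrank_eq_one_iff.mp h
  · exact absurd (eq_of_le_of_finrank_eq hM.le h) hM.ne

/-- In characteristic `p`, adjoining a `p`-th root not in the base field gives an atom. -/
theorem IntermediateField.isAtom_adjoin_simple_of_pow_mem {F E : Type*} [Field F] [Field E]
    [Algebra F E] {p : ℕ} (hp : p.Prime) [ExpChar E p] {x : E}
    (hx : x ∉ (⊥ : IntermediateField F E)) (hxp : x ^ p ∈ (⊥ : IntermediateField F E)) :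
    IsAtom F⟮x⟯ := by
  obtain ⟨a, ha⟩ := mem_bot.mp hxp
  have hroot : aeval x (X ^ p - C a) = 0 := by simp [ha]
  have hmonic : (X ^ p - C a).Monic := monic_X_pow_sub_C a hp.ne_zero
  have hirr : Irreducible (X ^ p - C a) := by
    refine X_pow_sub_C_irreducible_of_prime hp fun b hb => hx (mem_bot.mpr ⟨b, ?_⟩)
    refine frobenius_inj E p ?_
    simp only [frobenius_def]
    rw [← ha, ← hb, map_pow]
  apply isAtom_of_finrank_prime_s17
  rwa [adjoin.finrank ⟨_, hmonic, hroot⟩, ← minpoly.eq_of_irreducible_of_monic hirr hroot hmonic,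
    natDegree_X_pow_sub_C]

/-- If `¬ T ≤ D` in a purely inseparable extension, some element of `T` outside `D` has its `q`-th
power in `D`. -/
theorem IsPurelyInseparable.exists_mem_notMem_pow_mem {k L : Type*} [Field k] [Field L]
    [Algebra k L] [IsPurelyInseparable k L] (q : ℕ) [ExpChar k q] {D T : IntermediateField k L}
    (h : ¬ T ≤ D) : ∃ x ∈ T, x ∉ D ∧ x ^ q ∈ D := by
  obtain ⟨x, hxT, hxD⟩ := SetLike.not_le_iff_exists.mp h
  have hex : ∃ n : ℕ, x ^ q ^ n ∈ D := by
    obtain ⟨n, y, hy⟩ := IsPurelyInseparable.pow_mem k q x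
    exact ⟨n, hy ▸ D.algebraMap_mem y⟩
  classical
  obtain ⟨m, hm⟩ : ∃ m, Nat.find hex = m + 1 :=
    Nat.exists_eq_succ_of_ne_zero fun h0 => hxD (by simpa [h0] using Nat.find_spec hex)
  refine ⟨x ^ q ^ m, _root_.pow_mem hxT _, Nat.find_min hex (by omega), ?_⟩
  rw [← pow_mul, ← pow_succ, ← hm]
  exact Nat.find_spec hex

/-- The intermediate fields of a purely inseparable extension form a chain if their lattice is
distributive. -/
theorem IsPurelyInseparable.le_total_of_distrib {k L : Type*} [Field k] [Field L] [Algebra k L]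
    [IsPurelyInseparable k L]
    (hd : ∀ a b c : IntermediateField k L, a ⊓ (b ⊔ c) = (a ⊓ b) ⊔ (a ⊓ c))
    (T U : IntermediateField k L) : T ≤ U ∨ U ≤ T := by
  by_contra! ⟨hTU, hUT⟩
  obtain ⟨q, hq⟩ := ExpChar.exists k
  have : ExpChar L q := expChar_of_injective_algebraMap (algebraMap k L).injective q
  obtain ⟨D, hD⟩ : ∃ D, D = T ⊓ U := ⟨_, rfl⟩
  have hDT : D ≤ T := hD.le.trans inf_le_left
  have hDU : D ≤ U := hD.le.trans inf_le_right
  have hD' {z : L} (hT : z ∈ T) (hU : z ∈ U) : z ∈ D := hD ▸ mem_inf.mpr ⟨hT, hU⟩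
  obtain ⟨x, hxT, hxD, hxq⟩ := exists_mem_notMem_pow_mem q (D := D) (T := T)
    fun h => hTU (h.trans hDU)
  obtain ⟨y, hyU, hyD, hyq⟩ := exists_mem_notMem_pow_mem q (D := D) (T := U)
    fun h => hUT (h.trans hDT)
  have hp : q.Prime := by
    rcases expChar_is_prime_or_one k q with h | rfl
    · exact h
    · exact absurd (by simpa using hxq) hxD
  have hbot (z : L) : z ∈ (⊥ : IntermediateField D L) ↔ z ∈ D :=
    mem_bot.trans ⟨fun ⟨d, hd⟩ => hd ▸ d.2, fun h => ⟨⟨z, h⟩, rfl⟩⟩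
  have hzx : x + y ∉ D⟮x⟯ := fun h => by
    have hDx : D⟮x⟯ ≤ extendScalars hDT := adjoin_simple_le_iff.mpr hxT
    have hzT : x + y ∈ T := (mem_extendScalars hDT).mp (hDx h)
    exact hyD (hD' (by simpa using sub_mem hzT hxT) hyU)
  have hzy : x + y ∉ D⟮y⟯ := fun h => by
    have hDy : D⟮y⟯ ≤ extendScalars hDU := adjoin_simple_le_iff.mpr hyU
    have hzU : x + y ∈ U := (mem_extendScalars hDU).mp (hDy h)
    exact hxD (hD' hxT (by simpa using sub_mem hzU hyU))
  have hzD : x + y ∉ (⊥ : IntermediateField D L) := fun h => hzx ((bot_le : ⊥ ≤ D⟮x⟯) h)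
  have haz : IsAtom D⟮x + y⟯ :=
    isAtom_adjoin_simple_of_pow_mem hp hzD
      (by rw [hbot, add_pow_expChar]; exact add_mem hxq hyq)
  have hz := mem_adjoin_simple_self D (x + y)
  have hinf {w : L} (hw : x + y ∉ D⟮w⟯) :
      D⟮x + y⟯.restrictScalars k ⊓ D⟮w⟯.restrictScalars k ≤ D := fun v hv => by
    have hdisj : Disjoint D⟮x + y⟯ D⟮w⟯ := haz.not_le_iff_disjoint.mp fun h => hw (h hz)
    rw [mem_inf, mem_restrictScalars, mem_restrictScalars] at hv
    exact (hbot v).mp (hdisj.le_bot (mem_inf.mpr hv))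
  have hsup : x + y ∈ D⟮x⟯.restrictScalars k ⊔ D⟮y⟯.restrictScalars k :=
    add_mem (le_sup_left (a := D⟮x⟯.restrictScalars k) (mem_adjoin_simple_self D x))
      (le_sup_right (b := D⟮y⟯.restrictScalars k) (mem_adjoin_simple_self D y))
  have hmem := mem_inf.mpr ⟨(mem_restrictScalars (K := k)).mpr hz, hsup⟩
  rw [hd] at hmem
  exact hzD ((hbot _).mpr (sup_le (hinf hzx) (hinf hzy) hmem))

/-- The intermediate fields of a simple purely inseparable extension form a chain. -/
theorem IsPurelyInseparable.le_total_of_adjoin_simple_eq_top {k L : Type*} [Field k] [Field L]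
    [Algebra k L] [FiniteDimensional k L] [IsPurelyInseparable k L] {α : L} (hα : k⟮α⟯ = ⊤)
    (T U : IntermediateField k L) : T ≤ U ∨ U ≤ T := by
  obtain ⟨q, hq⟩ := ExpChar.exists k
  have key (K : IntermediateField k L) : ∃ n : ℕ, α ^ q ^ n ∈ K ∧
      ∀ M : IntermediateField k L, α ^ q ^ n ∈ M → K ≤ M := by
    have : ExpChar K q := expChar_of_injective_algebraMap (algebraMap k K).injective q
    have : IsPurelyInseparable K L := IsPurelyInseparable.tower_top k K L
    obtain ⟨n, y, hy⟩ := IsPurelyInseparable.minpoly_eq_X_pow_sub_C K q α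
    have hαy : α ^ q ^ n = y := by
      have := minpoly.aeval K α
      rw [hy] at this
      simpa [sub_eq_zero] using this
    refine ⟨n, hαy ▸ y.2, fun M hM => ?_⟩
    rw [← adjoin_minpoly_coeff_of_exists_primitive_element k hα K, adjoin_le_iff]
    intro c hc
    obtain ⟨i, -, rfl⟩ := mem_coeffs_iff.mp hc
    rw [hαy] at hM
    simp only [hy, Polynomial.map_sub, Polynomial.map_pow, map_X, map_C, coeff_sub, coeff_X_pow,
      coeff_C, SetLike.mem_coe]
    refine sub_mem ?_ ?_ <;> split_ifs
    exacts [one_mem M, zero_mem M, hM, zero_mem M]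
  obtain ⟨n, hnT, hT⟩ := key T
  obtain ⟨m, hmU, hU⟩ := key U
  have hpow {K : IntermediateField k L} {i j : ℕ} (hij : i ≤ j) (h : α ^ q ^ i ∈ K) :
      α ^ q ^ j ∈ K := by
    obtain ⟨d, rfl⟩ := Nat.exists_eq_add_of_le hij
    rw [pow_add, pow_mul]
    exact _root_.pow_mem h _
  exact (le_total m n).imp (fun h => hT U (hpow h hmU)) fun h => hU T (hpow h hnT)

/-- A finite extension whose intermediate fields form a chain has finitely many of them. -/
theorem IntermediateField.finite_of_le_total {k L : Type*} [Field k] [Field L] [Algebra k L]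
    [FiniteDimensional k L] (h : ∀ T U : IntermediateField k L, T ≤ U ∨ U ≤ T) :
    Finite (IntermediateField k L) := by
  refine Finite.of_injective (β := Fin (Module.finrank k L + 1))
    (fun K => ⟨Module.finrank k K, Nat.lt_succ_of_le K.toSubmodule.finrank_le⟩) fun T U hTU => ?_
  have heq : Module.finrank k T = Module.finrank k U := congrArg Fin.val hTU
  exact (h T U).elim (eq_of_le_of_finrank_eq · heq) fun hle =>
    (eq_of_le_of_finrank_eq hle heq.symm).symm

theorem purelyInseparable_chain_iff_distributive_iff_fip
    {k L : Type*} [Field k] [Field L] [Algebra k L]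
    [FiniteDimensional k L] [IsPurelyInseparable k L] :
    ((∀ T U : IntermediateField k L, T ≤ U ∨ U ≤ T) ↔
      (∀ a b c : IntermediateField k L, a ⊓ (b ⊔ c) = (a ⊓ b) ⊔ (a ⊓ c))) ∧
    ((∀ T U : IntermediateField k L, T ≤ U ∨ U ≤ T) ↔
      Finite (IntermediateField k L)) := by
  refine ⟨⟨fun h a b c => ?_, IsPurelyInseparable.le_total_of_distrib⟩,
    IntermediateField.finite_of_le_total, fun _ => ?_⟩
  · refine le_antisymm ?_ le_inf_sup
    rcases h b c with hbc | hcb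
    · exact (sup_eq_right.mpr hbc).symm ▸ le_sup_right
    · exact (sup_eq_left.mpr hcb).symm ▸ le_sup_left
  · obtain ⟨α, hα⟩ := Field.exists_primitive_element_of_finite_intermediateField k L ⊤
    exact IsPurelyInseparable.le_total_of_adjoin_simple_eq_top hα
end

section
/- Let k ⊆ N be a finite Galois field extension and let L ∈ IntermediateField k N be an atom (so k ⊂ L is a minimal separable extension) such that N is the normal closure of L over k, i.e. the supremum of the images L.map σ over all σ : N ≃ₐ[k] N equals ⊤. Then: (1) sSup {A ∈ [k,N] | A is an atom} = ⊤, i.e. the Loewy length of k ⊆ N is 1; (2) the following are equivalent: (a) the lattice IntermediateField k N is distributive; (b) the lattice IntermediateField k N is Boolean (distributive and every element has a complement); (c) the Galois group N ≃ₐ[k] N is cyclic and Module.finrank k N is squarefree. -/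
/-- If the subgroup lattice of a group is distributive, then the group is commutative: the
subgroup generated by `a` and `b` is generated by `a * b` and the central subgroup
`zpowers a ⊓ zpowers b`. -/
theorem Subgroup.commute_of_sup_inf_distrib {G : Type*} [Group G]
    (h : ∀ A B C : Subgroup G, A ⊔ (B ⊓ C) = (A ⊔ B) ⊓ (A ⊔ C)) (a b : G) : Commute a b := by
  have hab : a * b ∈ zpowers (a * b) := mem_zpowers _
  have ha : a ∈ zpowers (a * b) ⊔ (zpowers a ⊓ zpowers b) := by
    rw [h]
    refine ⟨mem_sup_right (mem_zpowers a), ?_⟩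
    simpa using mul_mem (mem_sup_left hab : a * b ∈ zpowers (a * b) ⊔ zpowers b)
      (inv_mem (mem_sup_right (mem_zpowers b)))
  have hle : zpowers (a * b) ⊔ (zpowers a ⊓ zpowers b) ≤ centralizer {a * b} := by
    refine sup_le ?_ fun z hz => ?_
    · simp [zpowers_le, mem_centralizer_singleton_iff]
    · obtain ⟨⟨m, rfl⟩, ⟨n, hn : b ^ n = a ^ m⟩⟩ := hz
      have h₁ : Commute (a ^ m) a := (Commute.refl a).zpow_left m
      have h₂ : Commute (a ^ m) b := by
        simpa only [hn] using (Commute.refl b).zpow_left n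
      exact mem_centralizer_singleton_iff.2 (h₁.mul_right h₂)
  have key := mem_centralizer_singleton_iff.1 (hle ha)
  rw [mul_assoc a b a] at key
  exact mul_left_cancel key

/-- A `k`-automorphism of `N` permutes the intermediate fields. -/
def IntermediateField.mapOrderIso {k N : Type*} [Field k] [Field N] [Algebra k N]
    (σ : N ≃ₐ[k] N) : IntermediateField k N ≃o IntermediateField k N where
  toFun A := A.map (σ : N →ₐ[k] N)
  invFun A := A.map (σ.symm : N →ₐ[k] N)
  left_inv A := by simpa [IntermediateField.map_map] using IntermediateField.map_id A
  right_inv A := by simpa [IntermediateField.map_map] using IntermediateField.map_id A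
  map_rel_iff' := Set.image_subset_image_iff σ.injective

/-- If the Galois group is commutative, every intermediate field is stable under it. -/
theorem IntermediateField.map_le_self_of_commute {k N : Type*} [Field k] [Field N] [Algebra k N]
    [FiniteDimensional k N] [IsGalois k N] (hcomm : ∀ σ τ : N ≃ₐ[k] N, Commute σ τ)
    (L : IntermediateField k N) (σ : N ≃ₐ[k] N) : L.map (σ : N →ₐ[k] N) ≤ L := by
  rintro _ ⟨x, hx, rfl⟩
  rw [← IsGalois.fixedField_fixingSubgroup L]
  rintro ⟨τ, hτ⟩
  have hτx : τ x = x := (IntermediateField.mem_fixingSubgroup_iff L τ).1 hτ x hx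
  change τ (σ x) = σ x
  calc τ (σ x) = σ (τ x) := DFunLike.congr_fun (hcomm τ σ) x
    _ = σ x := by rw [hτx]

/-- If the lattice of intermediate fields of a finite Galois extension is distributive, then
the Galois group is commutative. -/
theorem IsGalois.commute_of_inf_sup_distrib {k N : Type*} [Field k] [Field N] [Algebra k N]
    [FiniteDimensional k N] [IsGalois k N]
    (h : ∀ a b c : IntermediateField k N, a ⊓ (b ⊔ c) = (a ⊓ b) ⊔ (a ⊓ c))
    (σ τ : N ≃ₐ[k] N) : Commute σ τ := by
  refine Subgroup.commute_of_sup_inf_distrib (fun A B C => ?_) σ τ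
  let e := IsGalois.intermediateFieldEquivSubgroup (F := k) (E := N)
  have key := congrArg e (h (e.symm (OrderDual.toDual A)) (e.symm (OrderDual.toDual B))
    (e.symm (OrderDual.toDual C)))
  simp only [map_inf, map_sup, OrderIso.apply_symm_apply] at key
  exact congrArg OrderDual.ofDual key

/-- A finite Galois extension without proper intermediate fields and with commutative Galois
group is cyclic of prime degree. -/
theorem IsGalois.isCyclic_and_prime_finrank {k N : Type*} [Field k] [Field N] [Algebra k N]
    [FiniteDimensional k N] [IsGalois k N] [IsSimpleOrder (IntermediateField k N)]
    (hcomm : ∀ σ τ : N ≃ₐ[k] N, Commute σ τ) :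
    IsCyclic (N ≃ₐ[k] N) ∧ (Module.finrank k N).Prime := by
  let : CommGroup (N ≃ₐ[k] N) := { (inferInstance : Group (N ≃ₐ[k] N)) with mul_comm := hcomm }
  have : IsSimpleOrder (Subgroup (N ≃ₐ[k] N))ᵒᵈ :=
    (IsGalois.intermediateFieldEquivSubgroup (F := k) (E := N)).symm.isSimpleOrder
  have : IsSimpleOrder (Subgroup (N ≃ₐ[k] N)) := isSimpleOrder_iff_isSimpleOrder_orderDual.2 this
  have : IsSimpleGroup (N ≃ₐ[k] N) :=
    { exists_pair_ne := (Subgroup.nontrivial_iff.1 inferInstance).exists_pair_ne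
      eq_bot_or_eq_top_of_normal := fun H _ => eq_bot_or_eq_top H }
  refine ⟨inferInstance, ?_⟩
  rw [← IsGalois.card_aut_eq_finrank]
  exact IsSimpleGroup.prime_card

/-- If the Galois group is commutative and `N` is the normal closure of an atom, then there
are no proper intermediate fields. -/
theorem IsGalois.isSimpleOrder_of_commute {k N : Type*} [Field k] [Field N] [Algebra k N]
    [FiniteDimensional k N] [IsGalois k N] (hcomm : ∀ σ τ : N ≃ₐ[k] N, Commute σ τ)
    (L : IntermediateField k N) (hL : IsAtom L)
    (hclosure : (⨆ σ : N ≃ₐ[k] N, L.map (σ : N →ₐ[k] N)) = ⊤) :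
    IsSimpleOrder (IntermediateField k N) := by
  have htop : L = ⊤ :=
    top_le_iff.1 (hclosure ▸ iSup_le (IntermediateField.map_le_self_of_commute hcomm L))
  exact isSimpleOrder_iff_isAtom_top.2 (htop ▸ hL)

/-- A bounded lattice with only two elements is Boolean. -/
theorem IsSimpleOrder.inf_sup_distrib_and_exists_compl {α : Type*} [Lattice α] [BoundedOrder α]
    [IsSimpleOrder α] :
    (∀ a b c : α, a ⊓ (b ⊔ c) = (a ⊓ b) ⊔ (a ⊓ c)) ∧
      ∀ a : α, ∃ a' : α, a ⊓ a' = ⊥ ∧ a ⊔ a' = ⊤ := by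
  refine ⟨fun a b c => ?_, fun a => ?_⟩
  · rcases eq_bot_or_eq_top a with rfl | rfl <;> simp
  · rcases eq_bot_or_eq_top a with rfl | rfl
    · exact ⟨⊤, by simp⟩
    · exact ⟨⊥, by simp⟩


theorem normal_closure_of_minimal_separable
    {k N : Type*} [Field k] [Field N] [Algebra k N]
    [FiniteDimensional k N] [IsGalois k N]
    (L : IntermediateField k N) (hL : IsAtom L)
    (hclosure : (⨆ σ : N ≃ₐ[k] N, L.map (σ : N →ₐ[k] N)) = ⊤) :
    sSup {A : IntermediateField k N | IsAtom A} = ⊤ ∧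
    (((∀ a b c : IntermediateField k N, a ⊓ (b ⊔ c) = (a ⊓ b) ⊔ (a ⊓ c)) ↔
      ((∀ a b c : IntermediateField k N, a ⊓ (b ⊔ c) = (a ⊓ b) ⊔ (a ⊓ c)) ∧
        ∀ T : IntermediateField k N, ∃ T' : IntermediateField k N,
          T ⊓ T' = ⊥ ∧ T ⊔ T' = ⊤)) ∧
    (((∀ a b c : IntermediateField k N, a ⊓ (b ⊔ c) = (a ⊓ b) ⊔ (a ⊓ c)) ∧
        ∀ T : IntermediateField k N, ∃ T' : IntermediateField k N,
          T ⊓ T' = ⊥ ∧ T ⊔ T' = ⊤) ↔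
      (IsCyclic (N ≃ₐ[k] N) ∧ Squarefree (Module.finrank k N)))) := by
  have hsimple := fun hcomm : ∀ σ τ : N ≃ₐ[k] N, Commute σ τ =>
    IsGalois.isSimpleOrder_of_commute hcomm L hL hclosure
  refine ⟨?_, ⟨fun h => ?_, And.left⟩, fun ⟨h, _⟩ => ?_, fun ⟨_, _⟩ => ?_⟩
  · rw [← top_le_iff, ← hclosure]
    exact iSup_le fun σ => le_sSup (((IntermediateField.mapOrderIso σ).isAtom_iff L).2 hL)
  · have := hsimple (IsGalois.commute_of_inf_sup_distrib h)
    exact IsSimpleOrder.inf_sup_distrib_and_exists_compl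
  · have hcomm := IsGalois.commute_of_inf_sup_distrib h
    have := hsimple hcomm
    exact (IsGalois.isCyclic_and_prime_finrank hcomm).imp_right fun hp => hp.prime.squarefree
  · let : CommGroup (N ≃ₐ[k] N) := IsCyclic.commGroup
    have := hsimple mul_comm
    exact IsSimpleOrder.inf_sup_distrib_and_exists_compl
end
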